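/- Fix an integer q ≥ 2 and an alphabet Σ_q of size q. Let n, ℓ, p, k be integers with p ≥ 2, ℓ ≥ 3p−3, k ≥ 1, k dividing n, ℓ ≤ n/k, and ℓ ≥ ⌈log_q(n/k − ℓ + 2)⌉ + p + 1. Then a_q(n + (p+3)·(k−1) + 1, ℓ, p) ≥ q^n; equivalently, there exists an injective map from Σ_q^n into A_q(n + (p+3)·(k−1) + 1, ℓ, p), i.e., an ℓ-window p-least-period avoiding code with (p+3)·(k−1)+1 redundancy symbols. -/

import Mathlib

/-- `p` is a period of the vector `s = (s_1, …, s_n)` (0-indexed here):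
`s_i = s_{i+p}` for all valid indices. -/
def IsPeriod {α : Type*} {n : ℕ} (s : Fin n → α) (p : ℕ) : Prop :=
  ∀ i : ℕ, ∀ h : i + p < n,
    s ⟨i, lt_of_le_of_lt (Nat.le_add_right i p) h⟩ = s ⟨i + p, h⟩

/-- The window of length `ℓ` of `s` starting at (0-indexed) position `i`. -/
def window {α : Type*} {n : ℕ} (s : Fin n → α) (i ℓ : ℕ) (h : i + ℓ ≤ n) :
    Fin ℓ → α :=
  fun j => s ⟨i + j, Nat.lt_of_lt_of_le (Nat.add_lt_add_left j.isLt i) h⟩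

/-- `s` is an `ℓ`-window `p`-least-period avoiding vector: no window of
length `ℓ` has any period `p'` with `1 ≤ p' < p`. -/
def LPAvoiding {α : Type*} {n : ℕ} (ℓ p : ℕ) (s : Fin n → α) : Prop :=
  ∀ i : ℕ, ∀ h : i + ℓ ≤ n, ∀ p', 1 ≤ p' → p' < p →
    ¬ IsPeriod (window s i ℓ h) p'

/-- `s` is an `ℓ`-window `p`-period avoiding vector: no window of
length `ℓ` has period `p`. -/
def PAvoiding {α : Type*} {n : ℕ} (ℓ p : ℕ) (s : Fin n → α) : Prop :=
  ∀ i : ℕ, ∀ h : i + ℓ ≤ n, ¬ IsPeriod (window s i ℓ h) p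

/-- `s` satisfies the `k`-RLL constraint w.r.t. the zero symbol `z`:
no window of length `k` consists entirely of `z`. -/
def RLLok {α : Type*} {n : ℕ} (z : α) (k : ℕ) (s : Fin n → α) : Prop :=
  ∀ i : ℕ, ∀ h : i + k ≤ n, ∃ j : Fin k, window s i k h j ≠ z

/-- Number of avoiding words of length `N`. -/
noncomputable def lpaCount (S : Type*) (ℓ p N : ℕ) : ℕ :=
  Nat.card {s : Fin N → S // LPAvoiding ℓ p s}

lemma lpa_prefix {S : Type*} {ℓ p N M : ℕ} (h : M ≤ N) (s : Fin N → S)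
    (hs : LPAvoiding ℓ p s) : LPAvoiding ℓ p (fun i : Fin M => s (Fin.castLE h i)) := by
  intro i hi p' h1 h2 hper
  exact hs i (hi.trans h) p' h1 h2 hper

lemma lpaCount_small {S : Type*} [Fintype S] {ℓ p N : ℕ} (h : N < ℓ) :
    lpaCount S ℓ p N = Fintype.card S ^ N := by
  classical
  have : ∀ s : Fin N → S, LPAvoiding ℓ p s := by
    intro s i hi
    omega
  unfold lpaCount
  rw [Nat.card_congr (Equiv.subtypeUnivEquiv this)]
  simp

lemma lpaCount_le {S : Type*} [Fintype S] (ℓ p N : ℕ) :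
    lpaCount S ℓ p N ≤ Fintype.card S ^ N := by
  classical
  unfold lpaCount
  have := Nat.card_le_card_of_injective
    (fun x : {s : Fin N → S // LPAvoiding ℓ p s} => x.1) Subtype.val_injective
  simpa using this

lemma lpaCount_step {S : Type*} [Fintype S] {ℓ p N r : ℕ} (hN : N + 1 = ℓ + r) (hpl : p ≤ ℓ) :
    Fintype.card S * lpaCount S ℓ p N ≤
      lpaCount S ℓ p (N + 1) + ∑ j ∈ Finset.Ico 1 p, lpaCount S ℓ p (r + j) := by
  classical
  let E : Finset (Fin (N + 1) → S) :=
    Finset.univ.filter fun s => LPAvoiding ℓ p (fun i : Fin N => s (Fin.castLE (Nat.le_succ N) i))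
  let A : Finset (Fin (N + 1) → S) := Finset.univ.filter fun s => LPAvoiding ℓ p s
  let B : ℕ → Finset (Fin (N + 1) → S) := fun j => Finset.univ.filter fun s =>
    LPAvoiding ℓ p (fun i : Fin N => s (Fin.castLE (Nat.le_succ N) i)) ∧
      IsPeriod (window s r ℓ (by omega)) j
  have hcount : ∀ M, lpaCount S ℓ p M =
      (Finset.univ.filter fun s : Fin M → S => LPAvoiding ℓ p s).card := by
    intro M
    unfold lpaCount
    rw [Nat.card_eq_fintype_card, Fintype.card_subtype]
  have hE : Fintype.card S * lpaCount S ℓ p N ≤ E.card := by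
    have hinj := Nat.card_le_card_of_injective
      (fun x : S × {s : Fin N → S // LPAvoiding ℓ p s} =>
        (⟨Fin.snoc x.2.1 x.1, by
          simp only [E, Finset.mem_filter, Finset.mem_univ, true_and]
          have : (fun i : Fin N => (Fin.snoc x.2.1 x.1 : Fin (N + 1) → S)
              (Fin.castLE (Nat.le_succ N) i)) = x.2.1 := by
            funext i
            exact Fin.snoc_castSucc (α := fun _ => S) x.1 x.2.1 i
          rw [this]
          exact x.2.2⟩ : E)) (by
        rintro ⟨a, s, hs⟩ ⟨b, t, ht⟩ h
        simp only [Subtype.mk.injEq] at h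
        have h' := Fin.snoc_injective2 (α := fun _ => S) h
        simp [h'.1, h'.2])
    rw [Nat.card_prod] at hinj
    simpa [lpaCount] using hinj
  have hsub : E ⊆ A ∪ (Finset.Ico 1 p).biUnion B := by
    intro s hs
    simp only [E, Finset.mem_filter, Finset.mem_univ, true_and] at hs
    by_cases hA : LPAvoiding ℓ p s
    · simp [A, hA]
    · refine Finset.mem_union_right _ ?_
      unfold LPAvoiding at hA
      push Not at hA
      obtain ⟨i, hi, p', h1, h2, hper⟩ := hA
      by_cases hi' : i + ℓ ≤ N
      · exact absurd hper (hs i hi' p' h1 h2)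
      · have : i = r := by omega
        subst this
        simp only [Finset.mem_biUnion, Finset.mem_Ico]
        refine ⟨p', ⟨h1, h2⟩, ?_⟩
        simp only [B, Finset.mem_filter, Finset.mem_univ, true_and]
        exact ⟨hs, hper⟩
  have hB : ∀ j ∈ Finset.Ico 1 p, (B j).card ≤ lpaCount S ℓ p (r + j) := by
    intro j hj
    rw [Finset.mem_Ico] at hj
    rw [hcount]
    have hle : r + j ≤ N := by omega
    refine Finset.card_le_card_of_injOn
      (fun s => fun i : Fin (r + j) => s (Fin.castLE (by omega) i)) ?_ ?_
    · intro s hs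
      simp only [B, Finset.coe_filter, Finset.mem_univ, true_and, Set.mem_setOf_eq] at hs ⊢
      exact lpa_prefix hle _ hs.1
    · intro s hs t ht hst
      simp only [B, Finset.coe_filter, Finset.mem_univ, true_and, Set.mem_setOf_eq] at hs ht
      have key : ∀ i : ℕ, ∀ hi : i < N + 1, s ⟨i, hi⟩ = t ⟨i, hi⟩ := by
        intro i
        induction i using Nat.strong_induction_on with
        | _ i ih =>
          intro hi
          by_cases hlt : i < r + j
          · exact congrFun hst ⟨i, hlt⟩
          · have e1 := hs.2 (i - r - j) (by omega)
            have e2 := ht.2 (i - r - j) (by omega)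
            simp only [window] at e1 e2
            have e3 : r + (i - r - j + j) = i := by omega
            simp only [e3] at e1 e2
            rw [← e1, ← e2]
            exact ih _ (by omega) _
      funext i
      exact key i.1 i.2
  calc _ ≤ E.card := hE
    _ ≤ (A ∪ (Finset.Ico 1 p).biUnion B).card := Finset.card_le_card hsub
    _ ≤ A.card + ((Finset.Ico 1 p).biUnion B).card := Finset.card_union_le _ _
    _ ≤ A.card + ∑ j ∈ Finset.Ico 1 p, (B j).card := by
        gcongr
        exact Finset.card_biUnion_le
    _ ≤ _ := by
        rw [hcount (N + 1)]
        gcongr with j hj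
        exact hB j hj

/-- Exponential growth from the recurrence. -/
lemma lpaCount_growth {S : Type*} [Fintype S] {ℓ p : ℕ} (hpl : p ≤ ℓ) (hp : 1 ≤ p) (β : ℝ)
    (hβ : 0 < β) (hβq : β ≤ Fintype.card S)
    (hsum : ∑ j ∈ Finset.Ico 1 p, β ^ j ≤ (Fintype.card S - β) * β ^ (ℓ - 1)) (N : ℕ) :
    β * lpaCount S ℓ p N ≤ lpaCount S ℓ p (N + 1) := by
  induction N using Nat.strong_induction_on with
  | _ N ih =>
    by_cases hN : N + 1 < ℓ
    · rw [lpaCount_small hN, lpaCount_small (show N < ℓ by omega)]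
      push_cast
      rw [pow_succ, mul_comm]
      gcongr
    · obtain ⟨r, hr⟩ : ∃ r, N + 1 = ℓ + r := ⟨N + 1 - ℓ, by omega⟩
      have hstep := lpaCount_step (S := S) hr hpl
      have hstep' : (Fintype.card S : ℝ) * lpaCount S ℓ p N ≤ lpaCount S ℓ p (N + 1) +
          ∑ j ∈ Finset.Ico 1 p, (lpaCount S ℓ p (r + j) : ℝ) := by exact_mod_cast hstep
      have hiter : ∀ t M, M + t ≤ N →
          β ^ t * lpaCount S ℓ p M ≤ lpaCount S ℓ p (M + t) := by
        intro t
        induction t with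
        | zero => intro M _; simp
        | succ t iht =>
          intro M hM
          have h1 := iht M (by omega)
          have h2 := ih (M + t) (by omega)
          calc β ^ (t + 1) * (lpaCount S ℓ p M : ℝ)
              = β * (β ^ t * lpaCount S ℓ p M) := by ring
            _ ≤ β * lpaCount S ℓ p (M + t) := by gcongr
            _ ≤ _ := h2
      have hpos : 0 < β ^ (ℓ - 1) := by positivity
      have hS : β ^ (ℓ - 1) * ∑ j ∈ Finset.Ico 1 p, (lpaCount S ℓ p (r + j) : ℝ) ≤
          (∑ j ∈ Finset.Ico 1 p, β ^ j) * lpaCount S ℓ p N := by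
        rw [Finset.mul_sum, Finset.sum_mul]
        refine Finset.sum_le_sum fun j hj => ?_
        rw [Finset.mem_Ico] at hj
        have h := hiter (ℓ - 1 - j) (r + j) (by omega)
        rw [show r + j + (ℓ - 1 - j) = N by omega] at h
        calc β ^ (ℓ - 1) * (lpaCount S ℓ p (r + j) : ℝ)
            = β ^ j * (β ^ (ℓ - 1 - j) * lpaCount S ℓ p (r + j)) := by
              rw [← mul_assoc, ← pow_add, show j + (ℓ - 1 - j) = ℓ - 1 by omega]
          _ ≤ _ := by gcongr
      have hS2 : ∑ j ∈ Finset.Ico 1 p, (lpaCount S ℓ p (r + j) : ℝ) ≤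
          (Fintype.card S - β) * lpaCount S ℓ p N := by
        refine le_of_mul_le_mul_left ?_ hpos
        calc _ ≤ _ := hS
          _ ≤ ((Fintype.card S - β) * β ^ (ℓ - 1)) * lpaCount S ℓ p N := by gcongr
          _ = _ := by ring
      linarith

lemma geom_aux (q p : ℕ) (hq : 2 ≤ q) : ∑ j ∈ Finset.Ico 1 p, q ^ j ≤ q ^ p := by
  induction p with
  | zero => simp
  | succ p ih =>
    rcases Nat.eq_zero_or_pos p with h | h
    · subst h; simp
    · rw [Finset.sum_Ico_succ_top h, pow_succ]
      nlinarith [Nat.zero_le (q ^ p)]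

/-- Union bound, for the single block. -/
lemma lpaCount_union {S : Type*} [Fintype S] {ℓ p : ℕ} (hq : 2 ≤ Fintype.card S) (hpl : p < ℓ)
    (t : ℕ) :
    Fintype.card S ^ (ℓ - 1 + t) * Fintype.card S ≤
      lpaCount S ℓ p (ℓ - 1 + t) * Fintype.card S + t * Fintype.card S ^ (p + t) := by
  induction t with
  | zero => rw [lpaCount_small (by omega)]; simp
  | succ t ih =>
    have h := lpaCount_step (S := S) (ℓ := ℓ) (p := p) (N := ℓ - 1 + t) (r := t) (by omega) hpl.le
    set q := Fintype.card S
    have h2 : ∑ j ∈ Finset.Ico 1 p, lpaCount S ℓ p (t + j) ≤ q ^ (t + p) := by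
      calc _ ≤ ∑ j ∈ Finset.Ico 1 p, q ^ t * q ^ j := by
            refine Finset.sum_le_sum fun j _ => ?_
            rw [← pow_add]
            exact lpaCount_le ℓ p _
        _ = q ^ t * ∑ j ∈ Finset.Ico 1 p, q ^ j := by rw [Finset.mul_sum]
        _ ≤ q ^ t * q ^ p := by gcongr; exact geom_aux q p hq
        _ = _ := by rw [pow_add]
    have h3 : q * lpaCount S ℓ p (ℓ - 1 + t) ≤
        lpaCount S ℓ p (ℓ - 1 + (t + 1)) + q ^ (p + t) := by
      rw [add_comm p t]
      exact h.trans (Nat.add_le_add_left h2 _)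
    calc q ^ (ℓ - 1 + (t + 1)) * q = q * (q ^ (ℓ - 1 + t) * q) := by ring
      _ ≤ q * (lpaCount S ℓ p (ℓ - 1 + t) * q + t * q ^ (p + t)) := by gcongr
      _ = (q * lpaCount S ℓ p (ℓ - 1 + t)) * q + t * q ^ (p + (t + 1)) := by ring
      _ ≤ (lpaCount S ℓ p (ℓ - 1 + (t + 1)) + q ^ (p + t)) * q + t * q ^ (p + (t + 1)) := by
          gcongr
      _ = _ := by ring

lemma lpaCount_single {S : Type*} [Fintype S] {ℓ p m : ℕ} (hq : 2 ≤ Fintype.card S)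
    (hpl : p + 2 ≤ ℓ) (hm : ℓ ≤ m) (hX : m + 2 ≤ Fintype.card S ^ (ℓ - p - 1) + ℓ) :
    Fintype.card S ^ m ≤ lpaCount S ℓ p (m + 1) := by
  have h := lpaCount_union (S := S) (ℓ := ℓ) (p := p) hq (by omega) (m + 2 - ℓ)
  rw [show ℓ - 1 + (m + 2 - ℓ) = m + 1 by omega] at h
  set q := Fintype.card S
  have h1 : (m + 2 - ℓ) * q ^ (p + (m + 2 - ℓ)) ≤ q ^ (m + 1) := by
    calc _ ≤ q ^ (ℓ - p - 1) * q ^ (p + (m + 2 - ℓ)) := by gcongr; omega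
      _ = _ := by rw [← pow_add]; congr 1; omega
  have h2 : q ^ (m + 1) * q ≤ lpaCount S ℓ p (m + 1) * q + q ^ (m + 1) := by omega
  have h3 : q ^ (m + 1) = q ^ m * q := pow_succ _ _
  have hq0 : 0 < q := by omega
  have h4 : q ^ (m + 1) ≤ lpaCount S ℓ p (m + 1) + q ^ m := by
    rw [h3] at h2 ⊢
    refine Nat.le_of_mul_le_mul_right ?_ hq0
    linarith
  have h5 : 2 * q ^ m ≤ q ^ (m + 1) := by
    rw [h3, mul_comm]; gcongr
  omega

lemma final_bound (q : ℝ) (hq : 2 ≤ q) (δ : ℝ) (h0 : 0 ≤ δ) (h1 : δ ≤ 1 / 2) (m p : ℕ)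
    (h : 2 * δ * ((m : ℝ) + p + 3) ≤ p + 3) :
    q ^ m ≤ (q * (1 - δ)) ^ (m + p + 3) := by
  have ham : ((1 : ℝ) / 2) ^ (2 * δ) ≤ 1 - δ := by
    have := Real.geom_mean_le_arith_mean2_weighted (w₁ := 2 * δ) (w₂ := 1 - 2 * δ)
      (p₁ := 1 / 2) (p₂ := 1) (by linarith) (by linarith) (by norm_num) (by norm_num) (by ring)
    rw [Real.one_rpow] at this
    linarith
  have hpow : ((1 : ℝ) / 2) ^ (p + 3) ≤ (1 - δ) ^ (m + p + 3) := by
    calc ((1 : ℝ) / 2) ^ (p + 3) = ((1 : ℝ) / 2) ^ ((p : ℝ) + 3) := by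
          rw [← Real.rpow_natCast]; push_cast; rfl
      _ ≤ ((1 : ℝ) / 2) ^ (2 * δ * ((m + p + 3 : ℕ) : ℝ)) := by
          refine Real.rpow_le_rpow_of_exponent_ge (by norm_num) (by norm_num) ?_
          push_cast
          exact h
      _ = (((1 : ℝ) / 2) ^ (2 * δ)) ^ (m + p + 3) := by
          rw [Real.rpow_mul (by norm_num), Real.rpow_natCast]
      _ ≤ _ := by gcongr
  calc q ^ m = q ^ m * (2 ^ (p + 3) * ((1 : ℝ) / 2) ^ (p + 3)) := by
        rw [← mul_pow]; norm_num
    _ ≤ q ^ m * (q ^ (p + 3) * (1 - δ) ^ (m + p + 3)) := by gcongr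
    _ = _ := by rw [mul_pow]; ring

lemma geom_real (β : ℝ) (hβ : 7 / 4 ≤ β) (p : ℕ) :
    ∑ j ∈ Finset.Ico 1 (p + 2), β ^ j ≤ 7 / 3 * β ^ (p + 1) := by
  induction p with
  | zero => simp; linarith
  | succ p ih =>
    rw [Finset.sum_Ico_succ_top (by omega)]
    have : 0 < β ^ (p + 1) := by positivity
    rw [show p + 1 + 1 = p + 2 from rfl, pow_succ β (p + 1)]
    nlinarith

lemma exists_growth (q d p m : ℕ) (hq : 2 ≤ q) (hd : 2 ≤ d) (hp : 2 ≤ p) (hdp : 2 * p ≤ d + 3)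
    (hm : m + 2 ≤ q ^ (d - 1) + (d + p)) :
    ∃ β : ℝ, 0 < β ∧ β ≤ q ∧ ∑ j ∈ Finset.Ico 1 p, β ^ j ≤ (q - β) * β ^ (d + p - 1) ∧
      (q : ℝ) ^ m ≤ β ^ (m + p + 3) := by
  have hqR : (2 : ℝ) ≤ q := by exact_mod_cast hq
  have hmR : (m : ℝ) + 2 ≤ (q : ℝ) ^ (d - 1) + (d + p) := by exact_mod_cast hm
  have hpR : (2 : ℝ) ≤ p := by exact_mod_cast hp
  have hdpR : 2 * (p : ℝ) ≤ d + 3 := by exact_mod_cast hdp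
  have hq0 : (0 : ℝ) < q := by linarith
  rcases (by omega : d = 2 ∨ d = 3 ∨ 4 ≤ d) with h | h | h
  · subst h
    obtain rfl : p = 2 := by omega
    refine ⟨q * (1 - 1 / (2 * q)), ?_, ?_, ?_, ?_⟩
    · field_simp; linarith
    · field_simp; linarith
    · have : (q : ℝ) * (1 - 1 / (2 * q)) = q - 1 / 2 := by field_simp
      rw [this]
      have hb : (3 : ℝ) / 2 ≤ q - 1 / 2 := by linarith
      set b := (q : ℝ) - 1 / 2
      have e : (q : ℝ) - b = 1 / 2 := by simp [b]
      rw [e]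
      norm_num
      nlinarith [mul_self_nonneg b, mul_pos (show 0 < b by linarith) (show 0 < b by linarith), mul_nonneg (show 0 ≤ b by linarith) (show 0 ≤ b * b - 2 by nlinarith)]
    · refine final_bound q hqR _ (by positivity) ?_ m 2 ?_
      · rw [div_le_div_iff₀ (by positivity) (by norm_num)]; linarith
      · norm_num at hmR ⊢
        field_simp
        linarith
  · subst h
    refine ⟨q * (1 - 4 / 5 / q ^ 2), ?_, ?_, ?_, ?_⟩
    · have : 4 / 5 / (q : ℝ) ^ 2 < 1 := by
        rw [div_lt_one (by positivity)]; nlinarith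
      exact mul_pos hq0 (by linarith)
    · have : 0 ≤ 4 / 5 / (q : ℝ) ^ 2 := by positivity
      nlinarith
    · have h4 : 4 / 5 / (q : ℝ) ^ 2 ≤ 1 / 5 := by
        rw [div_le_iff₀ (by positivity)]; nlinarith
      have hb : 4 / 5 * (q : ℝ) ≤ q * (1 - 4 / 5 / q ^ 2) := by nlinarith
      have e : (q : ℝ) - q * (1 - 4 / 5 / q ^ 2) = 4 / 5 / q := by field_simp; ring
      rw [e]
      set b := (q : ℝ) * (1 - 4 / 5 / q ^ 2)
      have hb2 : 8 / 5 ≤ b := by linarith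
      have hb0 : 0 < b := by linarith
      have h3 : 13 / 8 ≤ 4 / 5 / (q : ℝ) * b ^ 3 := by
        calc (13 : ℝ) / 8 ≤ 4 / 5 * (64 / 125) * q ^ 2 := by nlinarith
          _ = 4 / 5 / (q : ℝ) * (4 / 5 * q) ^ 3 := by field_simp; norm_num
          _ ≤ _ := by gcongr
      rcases (by omega : p = 2 ∨ p = 3) with rfl | rfl
      · norm_num
        calc b ≤ 13 / 8 * b := by linarith
          _ ≤ (4 / 5 / (q : ℝ) * b ^ 3) * b := by gcongr
          _ = _ := by ring
      · rw [Finset.sum_Ico_succ_top (by norm_num), Finset.sum_Ico_succ_top (by norm_num)]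
        norm_num
        calc b + b ^ 2 ≤ 13 / 8 * b ^ 2 := by nlinarith
          _ ≤ (4 / 5 / (q : ℝ) * b ^ 3) * b ^ 2 := by gcongr
          _ = _ := by ring
    · refine final_bound q hqR _ (by positivity) ?_ m p ?_
      · rw [div_le_iff₀ (by positivity)]; nlinarith
      · norm_num at hmR
        have hX : (4 : ℝ) ≤ (q : ℝ) ^ 2 := by nlinarith
        rw [show 2 * (4 / 5 / (q : ℝ) ^ 2) * ((m : ℝ) + p + 3) =
          (8 / 5 * ((m : ℝ) + p + 3)) / q ^ 2 by ring, div_le_iff₀ (by positivity)]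
        nlinarith
  · obtain ⟨e, rfl⟩ : ∃ e, d = e + 1 := ⟨d - 1, by omega⟩
    have he : 3 ≤ e := by omega
    simp only [Nat.add_sub_cancel] at hmR
    set X : ℝ := (q : ℝ) ^ e with hXdef
    have h2X : (2 : ℝ) ^ e ≤ X := by rw [hXdef]; gcongr
    have h8 : (8 : ℝ) ≤ 2 ^ e := by
      calc (8 : ℝ) = 2 ^ 3 := by norm_num
        _ ≤ 2 ^ e := by gcongr; norm_num
    have h2e : ∀ k : ℕ, 2 * ((k : ℝ) + 4) ≤ 2 ^ (k + 3) := by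
      intro k
      induction k with
      | zero => norm_num
      | succ k ih => push_cast; rw [show k + 1 + 3 = k + 3 + 1 from rfl, pow_succ]; have : (0:ℝ) ≤ k := by positivity
                     linarith
    have h165 : ∀ k : ℕ, 16 * ((k : ℝ) + 5) ≤ 5 * 2 ^ (k + 4) := by
      intro k
      induction k with
      | zero => norm_num
      | succ k ih => push_cast; rw [show k + 1 + 4 = k + 4 + 1 from rfl, pow_succ]; have : (0:ℝ) ≤ k := by positivity
                     linarith
    have hX8 : 8 ≤ X := h8.trans h2X
    have hX0 : 0 < X := by linarith
    have hinv : 1 / X ≤ 1 / 8 := by gcongr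
    have hinv0 : 0 < 1 / X := by positivity
    have hb : 7 / 8 * (q : ℝ) ≤ q * (1 - 1 / X) := by nlinarith
    refine ⟨q * (1 - 1 / X), by linarith, by nlinarith, ?_, ?_⟩
    · obtain ⟨p, rfl⟩ : ∃ p', p = p' + 2 := ⟨p - 2, by omega⟩
      have hpw : (7 / 8 : ℝ) ^ 4 ≤ (1 - 1 / X) ^ (e + 1) := by
        rcases (by omega : e = 3 ∨ 4 ≤ e) with rfl | h4
        · gcongr; linarith
        · obtain ⟨k, rfl⟩ : ∃ k, e = k + 4 := ⟨e - 4, by omega⟩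
          have hB := one_add_mul_le_pow (a := -(1 / X)) (by linarith) (k + 4 + 1)
          have h16 := h165 k
          have : ((k + 4 + 1 : ℕ) : ℝ) * (1 / X) ≤ 5 / 16 := by
            rw [mul_one_div, div_le_iff₀ hX0]; push_cast; linarith
          rw [← sub_eq_add_neg] at hB
          norm_num at hB this ⊢
          linarith
      have h7 : 7 / 3 ≤ ((q : ℝ) - q * (1 - 1 / X)) * (q * (1 - 1 / X)) ^ (e + 1) := by
        have : ((q : ℝ) - q * (1 - 1 / X)) * (q * (1 - 1 / X)) ^ (e + 1) =
            q ^ 2 * (1 - 1 / X) ^ (e + 1) := by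
          rw [mul_pow, pow_succ (q : ℝ) e, ← hXdef]
          generalize (1 - 1 / X) ^ (e + 1) = y
          field_simp
          ring
        rw [this]
        calc (7 : ℝ) / 3 ≤ 2 ^ 2 * (7 / 8) ^ 4 := by norm_num
          _ ≤ _ := by gcongr
      set b := (q : ℝ) * (1 - 1 / X)
      have hb0 : 0 < b := by linarith
      calc _ ≤ 7 / 3 * b ^ (p + 1) := geom_real b (by linarith) p
        _ ≤ ((q : ℝ) - b) * b ^ (e + 1) * b ^ (p + 1) := by gcongr
        _ = _ := by rw [mul_assoc, ← pow_add]; congr 2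
    · refine final_bound q hqR _ hinv0.le (by linarith) m p ?_
      rw [show 2 * (1 / X) * ((m : ℝ) + p + 3) = (2 * ((m : ℝ) + p + 3)) / X by ring,
        div_le_iff₀ hX0]
      obtain ⟨k, rfl⟩ : ∃ k, e = k + 3 := ⟨e - 3, by omega⟩
      have := h2e k
      push_cast at hmR
      nlinarith

/-- Construction 4: for `p ≥ 2`, `ℓ ≥ 3p−3`, `k ≥ 1`, `k ∣ n`, `ℓ ≤ n/k`, and
`ℓ ≥ ⌈log_q(n/k − ℓ + 2)⌉ + p + 1`, we have
`a_q(n + (p+3)·(k−1) + 1, ℓ, p) ≥ q^n`, i.e. an `(ℓ,p)`-LPA code with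
`(p+3)·(k−1)+1` redundancy symbols exists. -/
theorem lpa_p3_redundancy_construction
    {q : ℕ} (hq : 2 ≤ q) (Sigma : Type*) [Fintype Sigma]
    (hcard : Fintype.card Sigma = q)
    (n ℓ p k : ℕ) (hp : 2 ≤ p) (hl3p : 3 * p - 3 ≤ ℓ) (hk : 1 ≤ k) (hkn : k ∣ n)
    (hlnk : ℓ ≤ n / k)
    (hℓ : ℓ ≥ ⌈Real.logb q (((n / k : ℕ) : ℝ) - (ℓ : ℝ) + 2)⌉₊ + p + 1) :
    Nat.card {s : Fin (n + (p + 3) * (k - 1) + 1) → Sigma // LPAvoiding ℓ p s} ≥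
      q ^ n := by
  classical
  subst hcard
  obtain ⟨m, rfl⟩ := hkn
  rw [Nat.mul_div_cancel_left m (by omega)] at hlnk hℓ
  set q := Fintype.card Sigma with hqdef
  have hqR : (2 : ℝ) ≤ q := by exact_mod_cast hq
  have hlm : (ℓ : ℝ) ≤ m := by exact_mod_cast hlnk
  set L := ⌈Real.logb q ((m : ℝ) - (ℓ : ℝ) + 2)⌉₊ with hL
  have hXL : (m : ℝ) - ℓ + 2 ≤ (q : ℝ) ^ L := by
    have h := Nat.le_ceil (Real.logb q ((m : ℝ) - (ℓ : ℝ) + 2))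
    rw [← hL, Real.logb_le_iff_le_rpow (by linarith) (by linarith), Real.rpow_natCast] at h
    exact h
  have hL1 : 1 ≤ L := by
    rw [hL, Nat.one_le_ceil_iff]
    exact Real.logb_pos (by linarith) (by linarith)
  have hXN : m + 2 ≤ q ^ (ℓ - p - 1) + ℓ := by
    have h1 : m + 2 ≤ q ^ L + ℓ := by
      have : (m : ℝ) + 2 ≤ (q : ℝ) ^ L + ℓ := by linarith
      exact_mod_cast this
    have h2 : q ^ L ≤ q ^ (ℓ - p - 1) := Nat.pow_le_pow_right (by omega) (by omega)
    omega
  obtain ⟨d, rfl⟩ : ∃ d, ℓ = d + p := ⟨ℓ - p, by omega⟩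
  rw [Nat.add_sub_cancel] at hXN
  have hsingle := lpaCount_single (S := Sigma) (ℓ := d + p) (p := p) (m := m) hq (by omega) hlnk
    (by rw [Nat.add_sub_cancel]; exact hXN)
  obtain ⟨β, hβ, hβq, hsum, hfin⟩ := exists_growth q d p m hq (by omega) hp (by omega) hXN
  have hgrow := lpaCount_growth (S := Sigma) (ℓ := d + p) (p := p) (by omega) (by omega) β hβ hβq
    hsum
  have hiter : ∀ t, β ^ t * lpaCount Sigma (d + p) p (m + 1) ≤
      lpaCount Sigma (d + p) p (m + 1 + t) := by
    intro t
    induction t with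
    | zero => simp
    | succ t ih =>
      calc β ^ (t + 1) * (lpaCount Sigma (d + p) p (m + 1) : ℝ)
          = β * (β ^ t * lpaCount Sigma (d + p) p (m + 1)) := by ring
        _ ≤ β * lpaCount Sigma (d + p) p (m + 1 + t) := by gcongr
        _ ≤ _ := hgrow _
  obtain ⟨j, rfl⟩ : ∃ j, k = j + 1 := ⟨k - 1, by omega⟩
  change q ^ ((j + 1) * m) ≤ lpaCount Sigma (d + p) p _
  have hlen : (j + 1) * m + (p + 3) * (j + 1 - 1) + 1 = m + 1 + (m + p + 3) * j := by
    rw [Nat.add_sub_cancel]; ring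
  rw [hlen]
  have hs' : (q : ℝ) ^ m ≤ lpaCount Sigma (d + p) p (m + 1) := by exact_mod_cast hsingle
  have : (q : ℝ) ^ ((j + 1) * m) ≤ lpaCount Sigma (d + p) p (m + 1 + (m + p + 3) * j) := by
    calc (q : ℝ) ^ ((j + 1) * m) = ((q : ℝ) ^ m) ^ j * (q : ℝ) ^ m := by
          rw [← pow_mul, ← pow_add]; congr 1; ring
      _ ≤ (β ^ (m + p + 3)) ^ j * lpaCount Sigma (d + p) p (m + 1) := by gcongr
      _ = β ^ ((m + p + 3) * j) * lpaCount Sigma (d + p) p (m + 1) := by rw [pow_mul]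
      _ ≤ _ := hiter _
  exact_mod_cast this
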